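/- Let X = {(x_k)_{k≥1} ∈ {0,1}^{ℕ⁺} : x_k · x_{2k} · x_{4k} = 0 for all k ≥ 1}, and let Ξ = {Σ_{k≥1} x_k 2^{-k} : (x_k) ∈ X} ⊆ [0,1]. Then the Hausdorff dimension of Ξ equals 2·log₂ z, where z is the unique real number in (1,2] satisfying z⁷ − 2z⁵ + z³ − z − 1 = 0. -/

import Mathlib

open scoped Classical ENNReal
open Filter MeasureTheory Topology

noncomputable section

/-- `Begins x u` : the finite word `u` is a prefix of the sequence `x` (indexed by `ℕ+`). -/
def Begins {m : ℕ} (x : ℕ+ → Fin m) (u : List (Fin m)) : Prop :=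
  ∀ j : Fin u.length, x ⟨(j : ℕ) + 1, Nat.succ_pos _⟩ = u.get j

/-- `Cyl u` : the cylinder set of the word `u`. -/
def Cyl {m : ℕ} (u : List (Fin m)) : Set (ℕ+ → Fin m) := {x | Begins x u}

/-- `Pref Ω` : the set of (finite) prefixes of sequences in `Ω`. -/
def Pref {m : ℕ} (Ω : Set (ℕ+ → Fin m)) : Set (List (Fin m)) := {u | ∃ x ∈ Ω, Begins x u}

/-- number of length-`n` words beginning some sequence of `X`. -/
def NWords {m : ℕ} (n : ℕ) (X : Set (ℕ+ → Fin m)) : ℕ :=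
  Set.ncard {u : List (Fin m) | u.length = n ∧ u ∈ Pref X}

/-- restriction of `x` to the geometric progression `J_i = {i, qi, q²i, …}`:
`(x|J_i)_k = x_{q^{k-1} i}` for `k ≥ 1`. -/
def RestrJ {m : ℕ} (q : ℕ+) (x : ℕ+ → Fin m) (i : ℕ+) : ℕ+ → Fin m :=
  fun k => x (q ^ ((k : ℕ) - 1) * i)

/-- the multiplicative subshift `X_Ω = {x : x|J_i ∈ Ω for all i with q ∤ i}`. -/
def XOm {m : ℕ} (q : ℕ+) (Ω : Set (ℕ+ → Fin m)) : Set (ℕ+ → Fin m) :=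
  {x | ∀ i : ℕ+, ¬ q ∣ i → RestrJ q x i ∈ Ω}

/-- the real number `Σ_{k≥1} x_k m^{-k}` with base-`m` digit sequence `x`. -/
def ValMap (m : ℕ) (x : ℕ+ → Fin m) : ℝ := ∑' k : ℕ+, ((x k : ℕ) : ℝ) * (m : ℝ)⁻¹ ^ (k : ℕ)

/-- the subset of `[0,1]` of reals whose base-`m` digit sequence lies in `X`. -/
def XiSet {m : ℕ} (X : Set (ℕ+ → Fin m)) : Set ℝ := {r | ∃ x ∈ X, r = ValMap m x}

/-- entropy (base-`m` logarithms) of the partition of `Ω` into `k`-cylinders, for a measure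
supported on `Ω` (words that are not prefixes of `Ω` get measure `0` and contribute nothing). -/
def Hent (m : ℕ) (μ : Measure (ℕ+ → Fin m)) (k : ℕ) : ℝ :=
  -∑ u : Fin k → Fin m,
    ((μ (Cyl (List.ofFn u))).toReal * Real.logb m (μ (Cyl (List.ofFn u))).toReal)

/-- `s(Ω,μ) = (q-1)² Σ_{k≥1} H_m^μ(α_k)/q^{k+1}`. -/
def sOm (m : ℕ) (q : ℕ+) (μ : Measure (ℕ+ → Fin m)) : ℝ :=
  ((q : ℝ) - 1) ^ 2 * ∑' k : ℕ, Hent m μ (k + 1) / (q : ℝ) ^ (k + 2)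

/-- cylinder determined by the first `n` entries of `x`, i.e. `[x₁…x_n]`. -/
def CylN {m : ℕ} (n : ℕ) (x : ℕ+ → Fin m) : Set (ℕ+ → Fin m) :=
  {y | ∀ k : ℕ+, (k : ℕ) ≤ n → y k = x k}

/-- the cylinder `[u|J_i]` where `u = x₁…x_n`: sequences `y` with
`y_{ℓ+1} = x_{q^ℓ i}` for all `ℓ ≥ 0` with `q^ℓ i ≤ n`. -/
def CylJ {m : ℕ} (q n i : ℕ+) (x : ℕ+ → Fin m) : Set (ℕ+ → Fin m) :=
  {y | ∀ ℓ : ℕ, q ^ ℓ * i ≤ n → y ⟨ℓ + 1, Nat.succ_pos _⟩ = x (q ^ ℓ * i)}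

/-- `P` has the product structure `P[u] = ∏_{i ≤ |u|, q ∤ i} μ[u|J_i]` on cylinders. -/
def ProdProp {m : ℕ} (q : ℕ+) (μ P : Measure (ℕ+ → Fin m)) : Prop :=
  ∀ (n : ℕ+) (x : ℕ+ → Fin m),
    P (CylN (n : ℕ) x) = ∏ i ∈ (Finset.Icc 1 n).filter (fun i => ¬ q ∣ i), μ (CylJ q n i x)

/-- `t` is a `[1, m^{1/(q-1)}]`-valued solution of `t(u)^q = Σ_{j : uj ∈ Pref(Ω)} t(uj)`
on the tree of prefixes of `Ω`. -/
def TSol {m : ℕ} (q : ℕ+) (Ω : Set (ℕ+ → Fin m)) (t : List (Fin m) → ℝ) : Prop :=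
  ∀ u ∈ Pref Ω,
    t u ∈ Set.Icc 1 ((m : ℝ) ^ ((1 : ℝ) / ((q : ℝ) - 1))) ∧
    t u ^ (q : ℕ) =
      ∑ j ∈ Finset.univ.filter (fun j : Fin m => u ++ [j] ∈ Pref Ω), t (u ++ [j])

/-- `μ` has the cylinder values `μ[u₁…u_k] = ∏_{j=1}^k t(u₁…u_j)/t(u₁…u_{j-1})^q`
for prefixes `u` of `Ω`. -/
def CylVals {m : ℕ} (q : ℕ+) (Ω : Set (ℕ+ → Fin m)) (t : List (Fin m) → ℝ)
    (μ : Measure (ℕ+ → Fin m)) : Prop :=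
  ∀ u ∈ Pref Ω,
    μ (Cyl u) =
      ENNReal.ofReal (∏ j ∈ Finset.range u.length, t (u.take (j + 1)) / t (u.take j) ^ (q : ℕ))

/-! ### Deterministic part: averages along geometric progressions -/

/-- partial sums `g 1 + ... + g n` -/
def pSum (g : ℕ → ℝ) (n : ℕ) : ℝ := ∑ k ∈ Finset.range n, g (k + 1)

/-- the second difference appearing in the log of the cylinder measure -/
def pDel (g : ℕ → ℝ) (n : ℕ) : ℝ := pSum g n - 2 * pSum g (n / 2)

/-- sum over the odd indices -/
def oSum (g : ℕ → ℝ) (N : ℕ) : ℝ := ∑ i ∈ Finset.range N, g (2 * i + 1)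

lemma pSum_split (g : ℕ → ℝ) (n : ℕ) :
    pSum g n = oSum g ((n + 1) / 2) + pSum (fun k => g (2 * k)) (n / 2) := by
  induction n with
  | zero => simp [pSum, oSum]
  | succ n ih =>
    have h1 : pSum g (n + 1) = pSum g n + g (n + 1) := by
      simp [pSum, Finset.sum_range_succ]
    rw [h1, ih]
    rcases Nat.even_or_odd' n with ⟨m, rfl | rfl⟩
    · have e1 : (2 * m + 1) / 2 = m := by omega
      have e2 : (2 * m + 1 + 1) / 2 = m + 1 := by omega
      have e3 : 2 * m / 2 = m := by omega
      rw [e1, e2, e3]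
      simp only [oSum, Finset.sum_range_succ]
      ring
    · have e1 : (2 * m + 1) / 2 = m := by omega
      have e2 : (2 * m + 1 + 1) / 2 = m + 1 := by omega
      have e3 : (2 * m + 1 + 1 + 1) / 2 = m + 1 := by omega
      rw [e1, e2, e3]
      simp only [pSum, Finset.sum_range_succ]
      rw [show 2 * (m + 1) = 2 * m + 1 + 1 by ring]
      ring

lemma pDel_split (g : ℕ → ℝ) (n : ℕ) :
    pDel g n = (oSum g ((n + 1) / 2) - 2 * oSum g ((n / 2 + 1) / 2)) +
      pDel (fun k => g (2 * k)) (n / 2) := by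
  unfold pDel
  rw [pSum_split g n, pSum_split g (n / 2)]
  ring

/-- bounded functions whose averages along each class `2^j * odd` converge -/
def AvgCls (K : ℝ) (g : ℕ → ℝ) : Prop :=
  (∀ k, |g k| ≤ K) ∧ ∀ j : ℕ, ∃ m : ℝ,
    Tendsto (fun N : ℕ => (∑ i ∈ Finset.range N, g (2 ^ j * (2 * i + 1))) / N) atTop (𝓝 m)

lemma AvgCls.double {K : ℝ} {g : ℕ → ℝ} (h : AvgCls K g) : AvgCls K (fun k => g (2 * k)) := by
  refine ⟨fun k => h.1 _, fun j => ?_⟩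
  obtain ⟨m, hm⟩ := h.2 (j + 1)
  refine ⟨m, ?_⟩
  have e : ∀ i : ℕ, 2 * (2 ^ j * (2 * i + 1)) = 2 ^ (j + 1) * (2 * i + 1) := by
    intro i
    ring
  simpa only [e] using hm

lemma pSum_abs_le {K : ℝ} {g : ℕ → ℝ} (h : ∀ k, |g k| ≤ K) (n : ℕ) : |pSum g n| ≤ K * n := by
  unfold pSum
  refine (Finset.abs_sum_le_sum_abs _ _).trans ?_
  refine (Finset.sum_le_sum fun k _ => h (k + 1)).trans ?_
  simp [mul_comm]

lemma pDel_abs_le {K : ℝ} {g : ℕ → ℝ} (h : ∀ k, |g k| ≤ K) (n : ℕ) :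
    |pDel g n| ≤ 2 * K * n := by
  have hK : 0 ≤ K := (abs_nonneg _).trans (h 0)
  have h1 := abs_le.1 (pSum_abs_le h n)
  have h2 := abs_le.1 (pSum_abs_le h (n / 2))
  have h3 : ((n / 2 : ℕ) : ℝ) ≤ n / 2 := Nat.cast_div_le
  have h4 : K * ((n / 2 : ℕ) : ℝ) ≤ K * (n / 2) := mul_le_mul_of_nonneg_left h3 hK
  unfold pDel
  rw [abs_le]
  constructor <;> linarith [h1.1, h1.2, h2.1, h2.2]

lemma oSum_diff {K : ℝ} {g : ℕ → ℝ} (h : AvgCls K g) {ε : ℝ} (hε : 0 < ε) :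
    ∀ᶠ n : ℕ in atTop, |oSum g ((n + 1) / 2) - 2 * oSum g ((n / 2 + 1) / 2)| ≤ ε * n := by
  obtain ⟨m, hm⟩ := h.2 0
  have hm' : ∀ᶠ N : ℕ in atTop, |oSum g N - m * N| ≤ (ε / 4) * N := by
    have := (Metric.tendsto_nhds.1 hm) (ε / 4) (by positivity)
    filter_upwards [this, eventually_gt_atTop 0] with N hN hN0
    have hN' : (0 : ℝ) < N := by exact_mod_cast hN0
    rw [Real.dist_eq] at hN
    simp only [pow_zero, one_mul] at hN
    have : oSum g N - m * N = (oSum g N / N - m) * N := by field_simp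
    rw [this, abs_mul, abs_of_pos hN']
    exact mul_le_mul_of_nonneg_right hN.le hN'.le
  obtain ⟨N0, hN0⟩ := eventually_atTop.1 hm'
  obtain ⟨N1, hN1⟩ := exists_nat_gt (4 * (|m| + 2 * ε) / ε)
  filter_upwards [eventually_ge_atTop (4 * N0 + N1 + 4)] with n hn
  have a1 := abs_le.1 (hN0 ((n + 1) / 2) (by omega))
  have a2 := abs_le.1 (hN0 ((n / 2 + 1) / 2) (by omega))
  set p := (n + 1) / 2 with hp
  set q := (n / 2 + 1) / 2 with hq
  have b1 : (p : ℝ) ≤ 2 * q + 1 := by exact_mod_cast (by omega : p ≤ 2 * q + 1)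
  have b2 : (2 * q : ℝ) ≤ p + 1 := by exact_mod_cast (by omega : 2 * q ≤ p + 1)
  have b3 : (2 * p : ℝ) ≤ n + 1 := by exact_mod_cast (by omega : 2 * p ≤ n + 1)
  have b4 : 4 * (|m| + 2 * ε) ≤ ε * n := by
    have : 4 * (|m| + 2 * ε) / ε ≤ n := hN1.le.trans (by exact_mod_cast (by omega))
    rw [div_le_iff₀ hε] at this
    linarith
  have b5 : |m * p - 2 * (m * q)| ≤ |m| := by
    have : m * p - 2 * (m * q) = m * (p - 2 * q) := by ring
    rw [this, abs_mul]
    have : |(p : ℝ) - 2 * q| ≤ 1 := abs_le.2 ⟨by linarith, by linarith⟩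
    nlinarith [abs_nonneg m]
  have b6 := abs_le.1 b5
  have c1 : ε / 4 * p ≤ ε / 8 * (n + 1) := by nlinarith
  have c2 : 2 * (ε / 4 * q) ≤ ε / 4 * (p + 1) := by nlinarith
  have hm0 := abs_nonneg m
  rw [abs_le]
  constructor <;> linarith [a1.1, a1.2, a2.1, a2.2, b6.1, b6.2]

lemma pDel_step {K c : ℝ} (hc : 0 < c)
    (h : ∀ g, AvgCls K g → ∀ᶠ n : ℕ in atTop, |pDel g n| ≤ c * n) :
    ∀ g, AvgCls K g → ∀ᶠ n : ℕ in atTop, |pDel g n| ≤ (3 / 4 * c) * n := by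
  intro g hg
  have h1 := oSum_diff hg (show 0 < c / 4 by positivity)
  have h2 := h _ hg.double
  have h3 : Tendsto (fun n : ℕ => n / 2) atTop atTop :=
    Nat.tendsto_div_const_atTop (by norm_num)
  filter_upwards [h1, h3.eventually h2] with n a1 a2
  rw [pDel_split]
  refine (abs_add_le _ _).trans ?_
  have h3 : ((n / 2 : ℕ) : ℝ) ≤ n / 2 := Nat.cast_div_le
  have h4 : c * ((n / 2 : ℕ) : ℝ) ≤ c * (n / 2) := mul_le_mul_of_nonneg_left h3 hc.le
  linarith

lemma pDel_small {K : ℝ} {g : ℕ → ℝ} (hg : AvgCls K g) {ε : ℝ} (hε : 0 < ε) :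
    ∀ᶠ n : ℕ in atTop, |pDel g n| ≤ ε * n := by
  have hK : 0 ≤ K := (abs_nonneg _).trans (hg.1 0)
  have key : ∀ r : ℕ, ∀ g, AvgCls K g → ∀ᶠ n : ℕ in atTop,
      |pDel g n| ≤ ((3 / 4) ^ r * (2 * K + 1)) * n := by
    intro r
    induction r with
    | zero =>
      intro g hg
      refine Eventually.of_forall fun n => (pDel_abs_le hg.1 n).trans ?_
      have : (0 : ℝ) ≤ n := by positivity
      nlinarith
    | succ r ih =>
      intro g hg
      have := pDel_step (by positivity) ih g hg
      filter_upwards [this] with n hn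
      refine hn.trans (le_of_eq ?_)
      ring
  have ht : Tendsto (fun r : ℕ => (3 / 4 : ℝ) ^ r * (2 * K + 1)) atTop (𝓝 (0 * (2 * K + 1))) :=
    (tendsto_pow_atTop_nhds_zero_of_lt_one (by norm_num) (by norm_num)).mul_const _
  rw [zero_mul] at ht
  obtain ⟨r, hr⟩ := (ht.eventually (gt_mem_nhds hε)).exists
  filter_upwards [key r g hg] with n hn
  refine hn.trans ?_
  have : (0 : ℝ) ≤ n := by positivity
  exact mul_le_mul_of_nonneg_right hr.le this

lemma pDel_freq {K : ℝ} {g : ℕ → ℝ} (hg : ∀ k, |g k| ≤ K) {ε : ℝ} (hε : 0 < ε) (N : ℕ) :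
    ∃ l, N < l ∧ -(ε * (2 : ℝ) ^ l) ≤ pDel g (2 ^ l) := by
  by_contra! hcon
  have key : ∀ r : ℕ, pSum g (2 ^ (N + r)) / 2 ^ (N + r) ≤ pSum g (2 ^ N) / 2 ^ N - r * ε := by
    intro r
    induction r with
    | zero => simp
    | succ r ih =>
      have h1 := hcon (N + (r + 1)) (by omega)
      unfold pDel at h1
      have e : 2 ^ (N + (r + 1)) / 2 = 2 ^ (N + r) := by
        rw [show N + (r + 1) = (N + r) + 1 by ring, pow_succ]; omega
      rw [e] at h1
      have h2 : (0 : ℝ) < 2 ^ (N + r) := by positivity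
      have e2 : (2 : ℝ) ^ (N + (r + 1)) = 2 * 2 ^ (N + r) := by ring
      rw [e2] at h1
      have h3 : pSum g (2 ^ (N + (r + 1))) / 2 ^ (N + (r + 1)) ≤
          pSum g (2 ^ (N + r)) / 2 ^ (N + r) - ε := by
        rw [e2, div_le_iff₀ (by positivity)]
        have : (pSum g (2 ^ (N + r)) / 2 ^ (N + r) - ε) * (2 * 2 ^ (N + r)) =
          2 * pSum g (2 ^ (N + r)) - ε * (2 * 2 ^ (N + r)) := by field_simp
        rw [this]; linarith
      push_cast
      linarith
  have bd : ∀ n : ℕ, |pSum g (2 ^ n) / 2 ^ n| ≤ K := by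
    intro n
    have h := pSum_abs_le hg (2 ^ n)
    push_cast at h
    rw [abs_div, abs_of_pos (by positivity : (0 : ℝ) < 2 ^ n), div_le_iff₀ (by positivity)]
    exact h
  obtain ⟨r, hr⟩ := exists_nat_gt (2 * K / ε)
  rw [div_lt_iff₀ hε] at hr
  have a1 := (abs_le.1 (bd (N + r))).1
  have a2 := (abs_le.1 (bd N)).2
  have a3 := key r
  linarith

/-! ### Binary expansions -/

/-- digits of a sequence, extended by zero at index zero -/
def dig (x : ℕ+ → Fin 2) (k : ℕ) : ℕ := if h : 0 < k then (x ⟨k, h⟩ : ℕ) else 0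

/-- integer with binary expansion `x_1 ... x_n` -/
def pref (x : ℕ+ → Fin 2) : ℕ → ℕ
  | 0 => 0
  | n + 1 => 2 * pref x n + dig x (n + 1)

lemma dig_le (x : ℕ+ → Fin 2) (k : ℕ) : dig x k ≤ 1 := by
  unfold dig
  split_ifs
  · have := (x ⟨k, by assumption⟩).2
    omega
  · omega

lemma pref_inj {x y : ℕ+ → Fin 2} {n : ℕ} (h : pref x n = pref y n) :
    ∀ k, k ≤ n → dig x k = dig y k := by
  induction n with
  | zero =>
    intro k hk
    have : k = 0 := by omega
    subst this
    simp [dig]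
  | succ n ih =>
    simp only [pref] at h
    have h1 := dig_le x (n + 1)
    have h2 := dig_le y (n + 1)
    intro k hk
    rcases Nat.lt_or_ge n k with h3 | h3
    · have : k = n + 1 := by omega
      subst this
      omega
    · exact ih (by omega) k h3

lemma pref_congr {x y : ℕ+ → Fin 2} {n : ℕ} (h : ∀ k, 1 ≤ k → k ≤ n → dig x k = dig y k) :
    pref x n = pref y n := by
  induction n with
  | zero => rfl
  | succ n ih =>
    simp only [pref]
    rw [ih fun k h1 h2 => h k h1 (by omega), h (n + 1) (by omega) le_rfl]

lemma pref_sum (x : ℕ+ → Fin 2) (n : ℕ) :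
    (pref x n : ℝ) / 2 ^ n = ∑ k ∈ Finset.range n, (dig x (k + 1) : ℝ) * (2 : ℝ)⁻¹ ^ (k + 1) := by
  induction n with
  | zero => simp [pref]
  | succ n ih =>
    rw [Finset.sum_range_succ, ← ih]
    simp only [pref]
    push_cast
    rw [inv_pow]
    field_simp
    ring

lemma summable_dig (x : ℕ+ → Fin 2) :
    Summable fun k : ℕ => (dig x (k + 1) : ℝ) * (2 : ℝ)⁻¹ ^ (k + 1) := by
  have hs : Summable fun k : ℕ => (2 : ℝ)⁻¹ ^ (k + 1) :=
    (summable_nat_add_iff 1).2 (summable_geometric_of_lt_one (by norm_num) (by norm_num))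
  refine Summable.of_nonneg_of_le (fun k => by positivity) (fun k => ?_) hs
  have : (dig x (k + 1) : ℝ) ≤ 1 := by exact_mod_cast dig_le x (k + 1)
  exact mul_le_of_le_one_left (by positivity) this

lemma pref_tendsto (x : ℕ+ → Fin 2) :
    Tendsto (fun n => (pref x n : ℝ) / 2 ^ n) atTop (𝓝 (ValMap 2 x)) := by
  have h := (summable_dig x).hasSum.tendsto_sum_nat
  have e : ValMap 2 x = ∑' k : ℕ, (dig x (k + 1) : ℝ) * (2 : ℝ)⁻¹ ^ (k + 1) := by
    unfold ValMap
    rw [← Equiv.tsum_eq Equiv.pnatEquivNat.symm]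
    refine tsum_congr fun k => ?_
    simp [dig, Nat.succPNat]
  rw [e]
  simpa only [pref_sum] using h

lemma pref_bounds (x : ℕ+ → Fin 2) (n r : ℕ) :
    2 ^ r * pref x n ≤ pref x (n + r) ∧ pref x (n + r) + 1 ≤ 2 ^ r * (pref x n + 1) := by
  induction r with
  | zero => simp
  | succ r ih =>
    have h1 := dig_le x (n + r + 1)
    rw [← Nat.add_assoc]
    simp only [pref]
    rw [pow_succ]
    constructor
    · nlinarith [ih.1]
    · nlinarith [ih.2]

lemma val_mem (x : ℕ+ → Fin 2) (n : ℕ) :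
    (pref x n : ℝ) / 2 ^ n ≤ ValMap 2 x ∧ ValMap 2 x ≤ ((pref x n : ℝ) + 1) / 2 ^ n := by
  constructor
  · refine ge_of_tendsto (pref_tendsto x) ?_
    filter_upwards [eventually_ge_atTop n] with m hm
    obtain ⟨r, rfl⟩ := Nat.exists_eq_add_of_le hm
    have h := (pref_bounds x n r).1
    have h' : (2 : ℝ) ^ r * pref x n ≤ pref x (n + r) := by exact_mod_cast h
    rw [div_le_div_iff₀ (by positivity) (by positivity), pow_add]
    have : (0 : ℝ) < 2 ^ n := by positivity
    nlinarith
  · refine le_of_tendsto (pref_tendsto x) ?_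
    filter_upwards [eventually_ge_atTop n] with m hm
    obtain ⟨r, rfl⟩ := Nat.exists_eq_add_of_le hm
    have h := (pref_bounds x n r).2
    have h' : (pref x (n + r) : ℝ) + 1 ≤ (2 : ℝ) ^ r * (pref x n + 1) := by exact_mod_cast h
    rw [div_le_div_iff₀ (by positivity) (by positivity), pow_add]
    have : (0 : ℝ) < 2 ^ n := by positivity
    nlinarith

/-! ### States -/

/-- standing assumption on `z` -/
def GoodZ (z : ℝ) : Prop := 1 < z ∧ z ^ 7 - 2 * z ^ 5 + z ^ 3 - z - 1 = 0

/-- the solution of the tree equations -/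
def tt (z : ℝ) : Fin 3 → ℝ := ![z ^ 2, z ^ 4 - z ^ 2, z]

/-- transition: the state is the number of trailing ones -/
def stp (s : Fin 3) (b : Bool) : Fin 3 :=
  if b then (if s = 0 then 1 else if s = 1 then 2 else 0) else 0

lemma tt_pos {z : ℝ} (h : GoodZ z) (s : Fin 3) : 0 < tt z s := by
  have h1 := h.1
  fin_cases s
  · simp [tt]; positivity
  · simp [tt]; nlinarith [sq_nonneg z, mul_pos (by linarith : 0 < z) (by linarith : 0 < z - 1)]
  · simp [tt]; linarith

lemma tt_eq0 (z : ℝ) : tt z 0 + tt z 1 = tt z 0 ^ 2 := by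
  simp [tt]; ring

lemma tt_eq1 {z : ℝ} (h : GoodZ z) : tt z 0 + tt z 2 = tt z 1 ^ 2 := by
  simp [tt]
  linear_combination (-z) * h.2

lemma tt_eq2 (z : ℝ) : tt z 0 = tt z 2 ^ 2 := by
  simp [tt]

/-- law of the next digit in state `s` -/
def bern (z : ℝ) (s : Fin 3) : Measure Bool :=
  ENNReal.ofReal (tt z 0 / tt z s ^ 2) • Measure.dirac false +
    ENNReal.ofReal (1 - tt z 0 / tt z s ^ 2) • Measure.dirac true

lemma tt_ratio_le {z : ℝ} (h : GoodZ z) (s : Fin 3) : tt z 0 / tt z s ^ 2 ≤ 1 := by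
  have h0 := tt_pos h 0
  have h1 := tt_pos h 1
  have h2 := tt_pos h 2
  have e0 := tt_eq0 z
  have e1 := tt_eq1 h
  have e2 := tt_eq2 z
  rw [div_le_one (pow_pos (tt_pos h s) 2)]
  fin_cases s <;> simp <;> linarith

instance bern_prob {z : ℝ} [hz : Fact (GoodZ z)] (s : Fin 3) : IsProbabilityMeasure (bern z s) := by
  constructor
  have h := hz.out
  simp only [bern, Measure.coe_add, Measure.coe_smul, Pi.add_apply, Pi.smul_apply, measure_univ,
    smul_eq_mul, mul_one]
  rw [← ENNReal.ofReal_add]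
  · simp
  · exact div_nonneg (tt_pos h 0).le (pow_pos (tt_pos h s) 2).le
  · linarith [tt_ratio_le h s]

lemma bern_stp {z : ℝ} (h : GoodZ z) (s : Fin 3) (b : Bool) :
    bern z s {c | stp s c = stp s b} = ENNReal.ofReal (tt z (stp s b) / tt z s ^ 2) := by
  have h0 := tt_pos h 0
  have h1 := tt_pos h 1
  have h2 := tt_pos h 2
  have e0 := tt_eq0 z
  have e1 := tt_eq1 h
  have e2 := tt_eq2 z
  have f0 : 1 - tt z 0 / tt z 0 ^ 2 = tt z 1 / tt z 0 ^ 2 := by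
    field_simp; linarith
  have f1 : 1 - tt z 0 / tt z 1 ^ 2 = tt z 2 / tt z 1 ^ 2 := by
    field_simp; linarith
  have f2 : 1 - tt z 0 / tt z 2 ^ 2 = 0 := by
    rw [e2]; field_simp; simp
  simp only [bern, Measure.coe_add, Measure.coe_smul, Pi.add_apply, Pi.smul_apply, smul_eq_mul,
    Measure.dirac_apply]
  fin_cases s <;> cases b <;> simp [stp, f0, f1, f2, Set.indicator]

/-- previous state, for position `k` -/
def prv (f : ℕ → Fin 3) (k : ℕ) : Fin 3 := if k % 2 = 1 then 0 else f (k / 2)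

/-- states of a sequence -/
def stx (x : ℕ+ → Fin 2) (k : ℕ) : Fin 3 :=
  if dig x k = 0 then 0 else if k % 2 = 1 ∨ dig x (k / 2) = 0 then 1 else 2

/-- the multiplicative subshift -/
def XX : Set (ℕ+ → Fin 2) := {x : ℕ+ → Fin 2 | ∀ k : ℕ+,
        (x k : ℕ) * (x (2 * k) : ℕ) * (x (4 * k) : ℕ) = 0}

lemma XX_dig {x : ℕ+ → Fin 2} (hx : x ∈ XX) (k : ℕ) (hk : 0 < k) :
    dig x k * dig x (2 * k) * dig x (4 * k) = 0 := by
  have := hx ⟨k, hk⟩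
  have h2 : 0 < 2 * k := by omega
  have h4 : 0 < 4 * k := by omega
  simp only [dig, hk, h2, h4, dif_pos]
  exact this

lemma stx_step {x : ℕ+ → Fin 2} (hx : x ∈ XX) (k : ℕ) (hk : 0 < k) :
    stx x k = stp (prv (stx x) k) (decide (dig x k ≠ 0)) := by
  by_cases h0 : dig x k = 0
  · simp [stx, h0, stp]
  · by_cases h1 : k % 2 = 1
    · simp [stx, h0, stp, prv, h1]
    · by_cases h2 : dig x (k / 2) = 0
      · simp [stx, h0, stp, prv, h1, h2]
      · by_cases h3 : k / 2 % 2 = 1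
        · simp [stx, h0, stp, prv, h1, h2, h3]
        · by_cases h4 : dig x (k / 2 / 2) = 0
          · simp [stx, h0, stp, prv, h1, h2, h3, h4]
          · exfalso
            have := XX_dig hx (k / 2 / 2) (by omega)
            rw [show 2 * (k / 2 / 2) = k / 2 by omega, show 4 * (k / 2 / 2) = k by omega] at this
            simp [h0, h2, h4] at this

/-! ### The random sequence -/

/-- index of the progression containing `k` -/
def oi (k : ℕ) : ℕ := (k / 2 ^ padicValNat 2 k) / 2

lemma v_odd (k : ℕ) (h : k % 2 = 1) : padicValNat 2 k = 0 :=
  padicValNat.eq_zero_of_not_dvd (by omega)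

lemma v_even (k : ℕ) (h : ¬ k % 2 = 1) (hk : 0 < k) :
    padicValNat 2 k = padicValNat 2 (k / 2) + 1 := by
  have e : k = 2 * (k / 2) := by omega
  have : Fact (Nat.Prime 2) := ⟨Nat.prime_two⟩
  conv_lhs => rw [e]
  rw [padicValNat.mul (by norm_num) (by omega), padicValNat_self]
  ring

lemma oi_even (k : ℕ) (h : ¬ k % 2 = 1) (hk : 0 < k) : oi k = oi (k / 2) := by
  unfold oi
  rw [v_even k h hk, pow_succ', Nat.div_div_eq_div_mul k 2, mul_comm 2]

lemma oi_eq (k : ℕ) (hk : 0 < k) : k = 2 ^ padicValNat 2 k * (2 * oi k + 1) := by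
  induction k using Nat.strong_induction_on with
  | _ k ih =>
    by_cases h : k % 2 = 1
    · rw [v_odd k h, oi, v_odd k h]; simp; omega
    · have := ih (k / 2) (by omega) (by omega)
      rw [oi_even k h hk, v_even k h hk, pow_succ']
      have e : k = 2 * (k / 2) := by omega
      rw [mul_assoc, ← this]
      exact e

lemma v_oi_pow (j i : ℕ) :
    padicValNat 2 (2 ^ j * (2 * i + 1)) = j ∧ oi (2 ^ j * (2 * i + 1)) = i := by
  induction j with
  | zero =>
    have h : (2 ^ 0 * (2 * i + 1)) % 2 = 1 := by omega
    refine ⟨v_odd _ h, ?_⟩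
    rw [oi, v_odd _ h]; omega
  | succ j ih =>
    have e : 2 ^ (j + 1) * (2 * i + 1) = 2 * (2 ^ j * (2 * i + 1)) := by ring
    have hp : 0 < 2 ^ j * (2 * i + 1) := by positivity
    have h2 : 2 * (2 ^ j * (2 * i + 1)) / 2 = 2 ^ j * (2 * i + 1) := by omega
    rw [e, v_even _ (by omega) (by omega), oi_even _ (by omega) (by omega), h2, ih.1, ih.2]
    exact ⟨rfl, rfl⟩

/-- the states along one progression, driven by `η` -/
def rn (η : ℕ × Fin 3 → Bool) : ℕ → Fin 3
  | 0 => stp 0 (η (0, 0))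
  | j + 1 => stp (rn η j) (η (j + 1, rn η j))

/-- sample space -/
abbrev OmT : Type := ℕ → ℕ × Fin 3 → Bool

/-- random states -/
def SS (ω : OmT) (k : ℕ) : Fin 3 := rn (ω (oi k)) (padicValNat 2 k)

/-- random sequence -/
def Xr (ω : OmT) : ℕ+ → Fin 2 := fun k => if SS ω k = 0 then 0 else 1

lemma SS_step (ω : OmT) (k : ℕ) (hk : 0 < k) :
    SS ω k = stp (prv (SS ω) k) (ω (oi k) (padicValNat 2 k, prv (SS ω) k)) := by
  by_cases h : k % 2 = 1
  · simp [SS, prv, h, v_odd k h, rn]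
  · simp only [SS, prv, h, if_false]
    rw [v_even k h hk, oi_even k h hk, rn]

lemma dig_Xr (ω : OmT) (k : ℕ) (hk : 0 < k) : dig (Xr ω) k = if SS ω k = 0 then 0 else 1 := by
  simp only [dig, hk, dif_pos, Xr]
  split_ifs <;> simp_all

lemma Xr_mem (ω : OmT) : Xr ω ∈ XX := by
  intro k
  have hk := k.pos
  have h1 := SS_step ω (2 * k) (by omega)
  have h2 := SS_step ω (4 * k) (by omega)
  have p1 : prv (SS ω) (2 * k) = SS ω k := by
    unfold prv; rw [if_neg (by omega)]; congr 1; omega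
  have p2 : prv (SS ω) (4 * k) = SS ω (2 * k) := by
    unfold prv; rw [if_neg (by omega)]; congr 1; omega
  rw [p1] at h1
  rw [p2] at h2
  have key : ∀ (s : Fin 3) (b c : Bool), s = 0 ∨ stp s b = 0 ∨ stp (stp s b) c = 0 := by decide
  simp only [Xr]
  rw [show (((2 * k : ℕ+)) : ℕ) = 2 * (k : ℕ) by simp,
    show (((4 * k : ℕ+)) : ℕ) = 4 * (k : ℕ) by simp]
  rcases key (SS ω k) (ω (oi (2 * k)) (padicValNat 2 (2 * k), SS ω k))
    (ω (oi (4 * k)) (padicValNat 2 (4 * k), SS ω (2 * k))) with h | h | h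
  · simp [h]
  · rw [← h1] at h
    simp [h]
  · rw [← h1, ← h2] at h
    simp [h]

lemma stx_Xr (ω : OmT) (k : ℕ) (hk : 0 < k) : stx (Xr ω) k = SS ω k := by
  induction k using Nat.strong_induction_on with
  | _ k ih =>
    rw [stx_step (Xr_mem ω) k hk]
    have e : prv (stx (Xr ω)) k = prv (SS ω) k := by
      unfold prv
      split_ifs with h
      · rfl
      · exact ih _ (by omega) (by omega)
    have hs := SS_step ω k hk
    rw [e, dig_Xr ω k hk]
    have key : ∀ (s : Fin 3) (b : Bool),
        stp s (decide ((if stp s b = 0 then 0 else 1) ≠ 0)) = stp s b := by decide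
    have := key (prv (SS ω) k) (ω (oi k) (padicValNat 2 k, prv (SS ω) k))
    rw [← hs] at this
    exact this

lemma stx_eq_zero (x : ℕ+ → Fin 2) (k : ℕ) : stx x k = 0 ↔ dig x k = 0 := by
  unfold stx
  split_ifs <;> simp_all

/-- cylinder event -/
def cylE (x : ℕ+ → Fin 2) (n : ℕ) : Set OmT := {ω | pref (Xr ω) n = pref x n}

lemma cylE_eq (x : ℕ+ → Fin 2) (n : ℕ) :
    cylE x n = {ω | ∀ k ∈ Finset.Icc 1 n,
      stp (prv (stx x) k) (ω (oi k) (padicValNat 2 k, prv (stx x) k)) = stx x k} := by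
  ext ω
  simp only [cylE, Set.mem_ofPred_eq, Finset.mem_Icc]
  constructor
  · intro h
    have hd := pref_inj h
    have hst : ∀ k, 1 ≤ k → k ≤ n → SS ω k = stx x k := by
      intro k hk hn
      rw [← stx_Xr ω k hk]
      unfold stx
      rw [hd k hn, hd (k / 2) (by omega)]
    rintro k ⟨hk, hn⟩
    have e : prv (stx x) k = prv (SS ω) k := by
      unfold prv
      split_ifs with h
      · rfl
      · exact (hst _ (by omega) (by omega)).symm
    rw [e, ← SS_step ω k hk]
    exact hst k hk hn
  · intro h
    have hst : ∀ k, 1 ≤ k → k ≤ n → SS ω k = stx x k := by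
      intro k
      induction k using Nat.strong_induction_on with
      | _ k ih =>
        intro hk hn
        have e : prv (stx x) k = prv (SS ω) k := by
          unfold prv
          split_ifs with h
          · rfl
          · exact (ih _ (by omega) (by omega) (by omega)).symm
        rw [SS_step ω k hk, ← e]
        exact h k ⟨hk, hn⟩
    refine pref_congr fun k hk hn => ?_
    rw [dig_Xr ω k hk, hst k hk hn]
    have := stx_eq_zero x k
    have h1 := dig_le x k
    split_ifs with h0
    · exact (this.1 h0).symm
    · have : dig x k ≠ 0 := fun h => h0 (this.2 h)
      omega

/-! ### The measure -/

/-- law of one progression -/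
def mu1 (z : ℝ) [Fact (GoodZ z)] : Measure (ℕ × Fin 3 → Bool) :=
  Measure.infinitePi fun p : ℕ × Fin 3 => bern z p.2

instance mu1_prob (z : ℝ) [Fact (GoodZ z)] : IsProbabilityMeasure (mu1 z) := by
  unfold mu1; infer_instance

/-- law of the whole configuration -/
def PP (z : ℝ) [Fact (GoodZ z)] : Measure OmT := Measure.infinitePi fun _ : ℕ => mu1 z

instance PP_prob (z : ℝ) [Fact (GoodZ z)] : IsProbabilityMeasure (PP z) := by
  unfold PP; infer_instance

lemma cyl_prod (z : ℝ) [hz : Fact (GoodZ z)] {x : ℕ+ → Fin 2} (hx : x ∈ XX) (n : ℕ) :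
    PP z (cylE x n) = ∏ k ∈ Finset.Icc 1 n,
      ENNReal.ofReal (tt z (stx x k) / tt z (prv (stx x) k) ^ 2) := by
  set e : ℕ → ℕ × (ℕ × Fin 3) := fun k => (oi k, (padicValNat 2 k, prv (stx x) k)) with he
  have hinj : ∀ k ∈ Finset.Icc 1 n, ∀ l ∈ Finset.Icc 1 n, e k = e l → k = l := by
    intro k hk l hl h
    simp only [he, Prod.mk.injEq] at h
    rw [oi_eq k (Finset.mem_Icc.1 hk).1, oi_eq l (Finset.mem_Icc.1 hl).1, h.1, h.2.1]
  set F : Set (ℕ × (ℕ × Fin 3) → Bool) := Set.pi ((Finset.Icc 1 n).image e)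
    (fun p => {c | ∀ k ∈ Finset.Icc 1 n, e k = p → stp p.2.2 c = stx x k}) with hF
  have hset : cylE x n = (MeasurableEquiv.curry ℕ (ℕ × Fin 3) Bool).symm ⁻¹' F := by
    rw [cylE_eq]
    ext ω
    simp only [Set.mem_ofPred_eq, Set.mem_preimage, hF, Set.mem_pi, Finset.coe_image,
      Set.mem_image]
    constructor
    · rintro h p ⟨k, hk, rfl⟩ l hl hkl
      rw [← hkl]
      exact h l hl
    · intro h k hk
      exact h (e k) ⟨k, hk, rfl⟩ k hk rfl
  have hmeas : MeasurableSet F := by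
    refine MeasurableSet.pi (Finset.countable_toSet _) fun p _ => ?_
    exact MeasurableSet.of_discrete
  rw [hset, ← Measure.map_apply (MeasurableEquiv.measurable _) hmeas]
  unfold PP mu1
  rw [Measure.infinitePi_map_curry_symm (fun (_ : ℕ) (p : ℕ × Fin 3) => bern z p.2), hF,
    Measure.infinitePi_pi _ (fun i _ => MeasurableSet.of_discrete), Finset.prod_image hinj]
  refine Finset.prod_congr rfl fun k hk => ?_
  have hs := stx_step hx k (Finset.mem_Icc.1 hk).1
  have e2 : {c | ∀ l ∈ Finset.Icc 1 n, e l = e k → stp (e k).2.2 c = stx x l} =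
      {c | stp (prv (stx x) k) c = stp (prv (stx x) k) (decide (dig x k ≠ 0))} := by
    ext c
    simp only [Set.mem_ofPred_eq]
    rw [← hs]
    constructor
    · intro h
      exact h k hk rfl
    · intro h l hl hlk
      rw [hinj l hl k hk hlk]
      exact h
  rw [e2]
  have := bern_stp hz.out (prv (stx x) k) (decide (dig x k ≠ 0))
  rw [← hs] at this ⊢
  exact this

/-- log weights -/
def gx (z : ℝ) (x : ℕ+ → Fin 2) (k : ℕ) : ℝ := Real.log (tt z (stx x k))

lemma cyl_log (z : ℝ) [hz : Fact (GoodZ z)] {x : ℕ+ → Fin 2} (hx : x ∈ XX) (n : ℕ) :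
    PP z (cylE x n) = ENNReal.ofReal
      (Real.exp (pDel (gx z x) n - 2 * ((n + 1) / 2 : ℕ) * Real.log (tt z 0))) := by
  have hp := fun s => tt_pos hz.out s
  rw [cyl_prod z hx n, ← ENNReal.ofReal_prod_of_nonneg
    (fun k _ => div_nonneg (hp _).le (pow_pos (hp _) 2).le)]
  congr 1
  set h : ℕ → ℝ := fun k => Real.log (tt z (prv (stx x) k)) with hh
  have e1 : ∀ k, tt z (stx x k) / tt z (prv (stx x) k) ^ 2 = Real.exp (gx z x k - 2 * h k) := by
    intro k
    rw [Real.exp_sub, gx, Real.exp_log (hp _), two_mul, Real.exp_add, hh, Real.exp_log (hp _)]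
    ring
  rw [Finset.prod_congr rfl fun k _ => e1 k, ← Real.exp_sum]
  congr 1
  have e2 : ∑ k ∈ Finset.Icc 1 n, (gx z x k - 2 * h k) = pSum (gx z x) n - 2 * pSum h n := by
    rw [Finset.sum_sub_distrib, ← Finset.mul_sum]
    unfold pSum
    rw [Finset.range_eq_Ico, Finset.sum_Ico_add' (fun k => gx z x k) 0 n 1,
      Finset.sum_Ico_add' (fun k => h k) 0 n 1]
    rfl
  rw [e2, pSum_split h n]
  have e3 : oSum h ((n + 1) / 2) = ((n + 1) / 2 : ℕ) * Real.log (tt z 0) := by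
    unfold oSum
    rw [Finset.sum_congr rfl (g := fun _ => Real.log (tt z 0))]
    · simp
    · intro i _
      simp only [hh, prv]
      rw [if_pos (by omega)]
  have e4 : (fun k => h (2 * k)) = gx z x := by
    funext k
    simp only [hh, prv, gx]
    rw [if_neg (by omega)]
    congr 3
    omega
  rw [e3, e4]
  unfold pDel
  ring

lemma rn_meas (j : ℕ) : Measurable fun η : ℕ × Fin 3 → Bool => rn η j := by
  induction j with
  | zero =>
    exact (Measurable.of_discrete (f := fun b : Bool => stp 0 b)).comp (measurable_pi_apply _)
  | succ j ih =>
    have h1 : Measurable fun η : ℕ × Fin 3 → Bool =>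
        (rn η j, fun s : Fin 3 => η (j + 1, s)) :=
      ih.prodMk (measurable_pi_lambda _ fun s => measurable_pi_apply _)
    exact (Measurable.of_discrete
      (f := fun p : Fin 3 × (Fin 3 → Bool) => stp p.1 (p.2 p.1))).comp h1

lemma SS_meas (k : ℕ) : Measurable fun ω : OmT => SS ω k :=
  (rn_meas _).comp (measurable_pi_apply _)

lemma dig_meas (k : ℕ) : Measurable fun ω : OmT => dig (Xr ω) k := by
  rcases Nat.eq_zero_or_pos k with rfl | hk
  · simp only [dig]
    exact measurable_const
  · simp only [dig_Xr _ k hk]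
    exact (Measurable.of_discrete (f := fun s : Fin 3 => if s = 0 then 0 else 1)).comp (SS_meas k)

lemma pref_meas (n : ℕ) : Measurable fun ω : OmT => pref (Xr ω) n := by
  induction n with
  | zero => exact measurable_const
  | succ n ih =>
    simp only [pref]
    exact (measurable_const.mul ih).add (dig_meas _)

lemma val_meas : Measurable fun ω : OmT => ValMap 2 (Xr ω) := by
  refine measurable_of_tendsto_metrizable (f := fun n ω => (pref (Xr ω) n : ℝ) / 2 ^ n) ?_ ?_
  · intro n
    exact ((measurable_from_top (f := fun m : ℕ => (m : ℝ))).comp (pref_meas n)).div_const _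
  · rw [tendsto_pi_nhds]
    intro ω
    exact pref_tendsto _

/-- bound for the log weights -/
def KK (z : ℝ) : ℝ := ∑ s : Fin 3, |Real.log (tt z s)|

lemma log_le_KK (z : ℝ) (s : Fin 3) : |Real.log (tt z s)| ≤ KK z :=
  Finset.single_le_sum (f := fun s => |Real.log (tt z s)|) (fun _ _ => abs_nonneg _)
    (Finset.mem_univ s)

lemma ae_avg (z : ℝ) [hz : Fact (GoodZ z)] : ∀ᵐ ω ∂(PP z), AvgCls (KK z) (gx z (Xr ω)) := by
  have key : ∀ j : ℕ, ∀ᵐ ω ∂(PP z), ∃ m : ℝ, Tendsto (fun N : ℕ =>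
      (∑ i ∈ Finset.range N, gx z (Xr ω) (2 ^ j * (2 * i + 1))) / N) atTop (𝓝 m) := by
    intro j
    set φ : (ℕ × Fin 3 → Bool) → ℝ := fun η => Real.log (tt z (rn η j)) with hφ
    have mφ : Measurable φ :=
      (Measurable.of_discrete (f := fun s : Fin 3 => Real.log (tt z s))).comp (rn_meas j)
    have hlaw : ∀ i : ℕ, (PP z).map (fun ω : OmT => ω i) = mu1 z := by
      intro i
      exact Measure.infinitePi_map_eval (fun _ : ℕ => mu1 z) i
    have := ProbabilityTheory.strong_law_ae_real (μ := PP z) (fun i (ω : OmT) => φ (ω i))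
      (Integrable.of_bound (mφ.comp (measurable_pi_apply _)).aestronglyMeasurable (KK z)
        (Eventually.of_forall fun ω => log_le_KK z _))
      (fun i i' hii => (ProbabilityTheory.iIndepFun_infinitePi
        (P := fun _ : ℕ => mu1 z) (X := fun _ => φ) (fun _ => mφ)).indepFun hii)
      (fun i => by
        have h0 : ProbabilityTheory.IdentDistrib (fun ω : OmT => ω i) (fun ω : OmT => ω 0)
            (PP z) (PP z) :=
          ⟨(measurable_pi_apply _).aemeasurable, (measurable_pi_apply _).aemeasurable,
            by rw [hlaw, hlaw]⟩
        exact h0.comp mφ)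
    filter_upwards [this] with ω hω
    refine ⟨∫ x : OmT, φ (x 0) ∂(PP z), ?_⟩
    have e : ∀ i : ℕ, gx z (Xr ω) (2 ^ j * (2 * i + 1)) = φ (ω i) := by
      intro i
      rw [gx, stx_Xr ω _ (by positivity), SS, (v_oi_pow j i).1, (v_oi_pow j i).2]
    simp only [e]
    exact hω
  have := ae_all_iff.2 key
  filter_upwards [this] with ω hω
  exact ⟨fun k => log_le_KK z _, hω⟩

/-! ### Upper bound -/

lemma half_rpow (n : ℕ) (d : ℝ) (hd : 0 ≤ d) :
    ENNReal.ofReal ((1 / 2) ^ n) ^ d = ENNReal.ofReal (Real.exp (-(n * (d * Real.log 2)))) := by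
  rw [ENNReal.ofReal_rpow_of_nonneg (by positivity) hd, Real.rpow_def_of_pos (by positivity),
    Real.log_pow]
  congr 2
  rw [one_div, Real.log_inv]
  ring

lemma upper_bd (z : ℝ) [hz : Fact (GoodZ z)] (d : NNReal)
    (hd : Real.log (tt z 0) < d * Real.log 2) : Measure.hausdorffMeasure (d : ℝ) (XiSet XX) ≠ ∞ := by
  set a := Real.log (tt z 0) with ha
  have ha0 : 0 < a := by
    refine Real.log_pos ?_
    simp only [tt, Matrix.cons_val_zero]
    have := hz.out.1
    nlinarith
  have hd0 : 0 < (d : ℝ) := by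
    have h2 := Real.log_pos (by norm_num : (1 : ℝ) < 2)
    by_contra hcon
    nlinarith
  set δ := (d * Real.log 2 - a) / 2 with hδ
  have hδ0 : 0 < δ := by rw [hδ]; linarith
  set E : ℕ → ℕ → Set OmT := fun l m => {ω | pref (Xr ω) (2 ^ l) = m} with hE
  set t : ℕ → ℕ × ℕ → Set ℝ := fun N p =>
    if N ≤ p.1 ∧ ENNReal.ofReal (Real.exp (-((2 : ℝ) ^ p.1 * (a + δ)))) ≤ PP z (E p.1 p.2) then
      Set.Icc ((p.2 : ℝ) / 2 ^ (2 ^ p.1)) (((p.2 : ℝ) + 1) / 2 ^ (2 ^ p.1)) else ∅ with ht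
  have hdiam : ∀ n m : ℕ, Metric.ediam (Set.Icc ((m : ℝ) / 2 ^ n) (((m : ℝ) + 1) / 2 ^ n)) =
      ENNReal.ofReal ((1 / 2) ^ n) := by
    intro n m
    rw [Real.ediam_Icc]
    congr 1
    rw [← sub_div, one_div_pow]
    ring
  have hsum : ∀ N, ∑' p, Metric.ediam (t N p) ^ (d : ℝ) ≤
      ∑' l : ℕ, ENNReal.ofReal (Real.exp (-δ)) ^ l := by
    intro N
    rw [ENNReal.tsum_prod']
    refine ENNReal.tsum_le_tsum fun l => ?_
    have h1 : ∀ m, Metric.ediam (t N (l, m)) ^ (d : ℝ) ≤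
        ENNReal.ofReal (Real.exp (-δ)) ^ l * PP z (E l m) := by
      intro m
      simp only [ht]
      split_ifs with hc
      · rw [hdiam, half_rpow _ _ hd0.le]
        refine le_trans ?_ (mul_le_mul_right hc.2 _)
        rw [← ENNReal.ofReal_pow (Real.exp_nonneg _), ← ENNReal.ofReal_mul (by positivity),
          ← Real.exp_nat_mul, ← Real.exp_add]
        refine ENNReal.ofReal_le_ofReal (Real.exp_le_exp.2 ?_)
        have hl : (l : ℝ) ≤ 2 ^ l := by exact_mod_cast (Nat.lt_two_pow_self).le
        have e : d * Real.log 2 = a + 2 * δ := by rw [hδ]; ring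
        rw [e]
        push_cast
        nlinarith
      · simp [hd0]
    refine (ENNReal.tsum_le_tsum h1).trans ?_
    rw [ENNReal.tsum_mul_left]
    have h2 : ∑' m, PP z (E l m) ≤ 1 := by
      have := tsum_measure_le_measure_univ (μ := PP z) (s := E l)
        (fun m => ((pref_meas (2 ^ l)) (measurableSet_singleton m)).nullMeasurableSet)
        (fun m m' hm => by
          refine Disjoint.aedisjoint (Set.disjoint_left.2 ?_)
          intro ω h1 h2
          exact hm (h1.symm.trans h2))
      simpa using this
    exact mul_le_of_le_one_right' h2
  have hfin : ∑' l : ℕ, ENNReal.ofReal (Real.exp (-δ)) ^ l < ∞ := by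
    rw [ENNReal.tsum_geometric]
    rw [ENNReal.inv_lt_top]
    refine tsub_pos_of_lt ?_
    rw [ENNReal.ofReal_lt_one]
    exact Real.exp_lt_one_iff.2 (by linarith)
  have hcov := Measure.hausdorffMeasure_le_liminf_tsum (d : ℝ) (XiSet XX) (l := atTop)
    (fun N : ℕ => ENNReal.ofReal ((1 / 2) ^ N)) (by
      rw [← ENNReal.ofReal_zero]
      exact ENNReal.tendsto_ofReal
        (tendsto_pow_atTop_nhds_zero_of_lt_one (by norm_num) (by norm_num))) t
    (Eventually.of_forall fun N p => by
      simp only [ht]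
      split_ifs with hc
      · rw [hdiam]
        refine ENNReal.ofReal_le_ofReal ?_
        exact pow_le_pow_of_le_one (by norm_num) (by norm_num)
          (hc.1.trans (Nat.lt_two_pow_self).le)
      · simp)
    (Eventually.of_forall fun N => by
      rintro _ ⟨x, hx, rfl⟩
      obtain ⟨l, hl, hl2⟩ := pDel_freq (g := gx z x) (fun k => log_le_KK z _) hδ0 N
      refine Set.mem_iUnion.2 ⟨(l, pref x (2 ^ l)), ?_⟩
      simp only [ht]
      rw [if_pos]
      · exact val_mem x _
      · refine ⟨hl.le, ?_⟩
        have h1 := cyl_log z hx (2 ^ l)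
        have h2 : cylE x (2 ^ l) = E l (pref x (2 ^ l)) := rfl
        rw [← h2, h1]
        refine ENNReal.ofReal_le_ofReal (Real.exp_le_exp.2 ?_)
        have e : 2 * ((2 ^ l + 1) / 2) = 2 ^ l := by
          obtain ⟨r, rfl⟩ := Nat.exists_eq_succ_of_ne_zero (by omega : l ≠ 0)
          rw [Nat.succ_eq_add_one, pow_succ]
          omega
        have e' : 2 * (((2 ^ l + 1) / 2 : ℕ) : ℝ) = 2 ^ l := by exact_mod_cast e
        rw [e', ← ha]
        linarith)
  refine ne_of_lt (lt_of_le_of_lt (hcov.trans ?_) hfin)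
  refine (liminf_le_liminf (Eventually.of_forall hsum)).trans ?_
  simp

/-! ### Lower bound -/

lemma lower_bd (z : ℝ) [hz : Fact (GoodZ z)] (d : NNReal) (hd0 : 0 < d)
    (hd : d * Real.log 2 < Real.log (tt z 0)) :
    Measure.hausdorffMeasure (d : ℝ) (XiSet XX) ≠ 0 := by
  have hdr : 0 < (d : ℝ) := hd0
  set a := Real.log (tt z 0) with ha
  have ha0 : 0 < a := by
    refine Real.log_pos ?_
    simp only [tt, Matrix.cons_val_zero]
    have := hz.out.1
    nlinarith
  set δ := a - d * Real.log 2 with hδ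
  have hδ0 : 0 < δ := by rw [hδ]; linarith
  set G : ℕ → Set OmT := fun N => {ω | ∀ n, N ≤ n →
    PP z (cylE (Xr ω) n) ≤ ENNReal.ofReal ((1 / 2) ^ n) ^ (d : ℝ)} with hG
  have hGex : ∃ N, PP z (G N) ≠ 0 := by
    by_contra! hcon
    have h0 : PP z (⋃ N, G N) = 0 := measure_iUnion_null hcon
    have h1 : ∀ᵐ ω ∂(PP z), ω ∈ ⋃ N, G N := by
      filter_upwards [ae_avg z] with ω hω
      obtain ⟨N, hN⟩ := eventually_atTop.1 (pDel_small hω hδ0)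
      refine Set.mem_iUnion.2 ⟨N, fun n hn => ?_⟩
      rw [cyl_log z (Xr_mem ω) n, half_rpow _ _ hdr.le]
      refine ENNReal.ofReal_le_ofReal (Real.exp_le_exp.2 ?_)
      have h3 := (abs_le.1 (hN n hn)).2
      have h4 : (n : ℝ) ≤ 2 * ((n + 1) / 2 : ℕ) := by
        exact_mod_cast (by omega : n ≤ 2 * ((n + 1) / 2))
      have h5 : (n : ℝ) * a ≤ 2 * ((n + 1) / 2 : ℕ) * a := mul_le_mul_of_nonneg_right h4 ha0.le
      have e : d * Real.log 2 = a - δ := by rw [hδ]; ring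
      rw [e, ← ha]
      linarith
    have h2 : PP z (⋃ N, G N)ᶜ = 0 := h1
    have h3 : PP z Set.univ ≤ PP z (⋃ N, G N) + PP z (⋃ N, G N)ᶜ := by
      rw [← Set.union_compl_self (⋃ N, G N)]
      exact measure_union_le _ _
    rw [h0, h2, measure_univ] at h3
    simp at h3
  obtain ⟨N, hN⟩ := hGex
  set V : OmT → ℝ := fun ω => ValMap 2 (Xr ω) with hV
  set ρ : Measure ℝ := ((PP z).restrict (G N)).map V with hρ
  have hball : ∀ (s : Set ℝ) (n : ℕ), N ≤ n → Metric.ediam s ≤ ENNReal.ofReal ((1 / 2) ^ n) →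
      ρ s ≤ 5 * ENNReal.ofReal ((1 / 2) ^ n) ^ (d : ℝ) := by
    intro s n hn hs
    refine (measure_mono subset_closure).trans ?_
    rw [← Metric.ediam_closure] at hs
    rw [hρ, Measure.map_apply val_meas isClosed_closure.measurableSet,
      Measure.restrict_apply (val_meas isClosed_closure.measurableSet)]
    rcases Set.eq_empty_or_nonempty (V ⁻¹' closure s ∩ G N) with h0 | ⟨ω0, hω0⟩
    · rw [h0]; simp
    have hcov : V ⁻¹' closure s ∩ G N ⊆ ⋃ i ∈ Finset.range 5,
        {ω | ω ∈ G N ∧ pref (Xr ω) n + 2 = pref (Xr ω0) n + i} := by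
      rintro ω ⟨hω1, hω2⟩
      have h1 : edist (V ω) (V ω0) ≤ ENNReal.ofReal ((1 / 2) ^ n) :=
        (Metric.edist_le_ediam_of_mem (s := closure s) (x := V ω) (y := V ω0) hω1 hω0.1).trans hs
      rw [edist_dist, ENNReal.ofReal_le_ofReal_iff (by positivity), Real.dist_eq] at h1
      have b1 := val_mem (Xr ω) n
      have b2 := val_mem (Xr ω0) n
      have hp : (0 : ℝ) < 2 ^ n := by positivity
      rw [div_le_iff₀ hp, le_div_iff₀ hp] at b1 b2
      have h2 : |V ω - V ω0| * 2 ^ n ≤ 1 := by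
        have := mul_le_mul_of_nonneg_right h1 hp.le
        rwa [← mul_pow, show (1 / 2 * 2 : ℝ) = 1 by norm_num, one_pow] at this
      rw [← abs_of_pos hp, ← abs_mul, sub_mul, abs_le] at h2
      simp only [hV] at h2
      have c1 : (pref (Xr ω) n : ℝ) ≤ pref (Xr ω0) n + 2 := by linarith [b1.1, b2.2, h2.2]
      have c2 : (pref (Xr ω0) n : ℝ) ≤ pref (Xr ω) n + 2 := by linarith [b1.2, b2.1, h2.1]
      have c1' : pref (Xr ω) n ≤ pref (Xr ω0) n + 2 := by exact_mod_cast c1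
      have c2' : pref (Xr ω0) n ≤ pref (Xr ω) n + 2 := by exact_mod_cast c2
      refine Set.mem_iUnion₂.2 ⟨pref (Xr ω) n + 2 - pref (Xr ω0) n, ?_, hω2, ?_⟩
      · rw [Finset.mem_range]; omega
      · omega
    refine (measure_mono hcov).trans ((measure_biUnion_finset_le _ _).trans ?_)
    have hone : ∀ i ∈ Finset.range 5, PP z {ω | ω ∈ G N ∧ pref (Xr ω) n + 2 =
        pref (Xr ω0) n + i} ≤ ENNReal.ofReal ((1 / 2) ^ n) ^ (d : ℝ) := by
      intro i _
      rcases Set.eq_empty_or_nonempty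
        {ω | ω ∈ G N ∧ pref (Xr ω) n + 2 = pref (Xr ω0) n + i} with h0 | ⟨ω1, hω1⟩
      · rw [h0]; simp
      refine le_trans (measure_mono ?_) (hω1.1 n hn)
      intro ω hω
      have h1 := hω.2
      have h2 := hω1.2
      show pref (Xr ω) n = pref (Xr ω1) n
      omega
    refine (Finset.sum_le_sum hone).trans ?_
    simp
  set C : ℝ≥0∞ := 5 * 2 ^ (d : ℝ) with hC
  have hC0 : C ≠ 0 := by
    rw [hC]
    exact mul_ne_zero (by norm_num) (ENNReal.rpow_pos (by norm_num) (by norm_num)).ne'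
  have hCt : C ≠ ∞ := by
    rw [hC]
    exact ENNReal.mul_ne_top (by norm_num) (ENNReal.rpow_ne_top_of_nonneg hdr.le (by norm_num))
  have hfrost : ∀ s : Set ℝ, Metric.ediam s ≤ ENNReal.ofReal ((1 / 2) ^ N) →
      ρ s ≤ C * Metric.ediam s ^ (d : ℝ) := by
    intro s hs
    rcases eq_or_ne (Metric.ediam s) 0 with h0 | h0
    · have hle : ∀ n, N ≤ n → ρ s ≤ 5 * ENNReal.ofReal ((1 / 2) ^ n) ^ (d : ℝ) := fun n hn =>
        hball s n hn (by rw [h0]; exact zero_le)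
      have ht : Tendsto (fun n : ℕ => 5 * ENNReal.ofReal ((1 / 2) ^ n) ^ (d : ℝ)) atTop
          (𝓝 (5 * (0 : ℝ≥0∞) ^ (d : ℝ))) := by
        refine ENNReal.Tendsto.const_mul ?_ (Or.inr (by norm_num))
        refine Tendsto.ennrpow_const _ ?_
        rw [← ENNReal.ofReal_zero]
        exact ENNReal.tendsto_ofReal
          (tendsto_pow_atTop_nhds_zero_of_lt_one (by norm_num) (by norm_num))
      rw [ENNReal.zero_rpow_of_pos hdr, mul_zero] at ht
      have : ρ s ≤ 0 := ge_of_tendsto ht (eventually_atTop.2 ⟨N, hle⟩)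
      exact this.trans (zero_le)
    · have hfin : Metric.ediam s ≠ ∞ := ne_top_of_le_ne_top ENNReal.ofReal_ne_top hs
      set D := (Metric.ediam s).toReal with hD
      have hDe : Metric.ediam s = ENNReal.ofReal D := (ENNReal.ofReal_toReal hfin).symm
      have hD0 : 0 < D := ENNReal.toReal_pos h0 hfin
      rw [hDe, ENNReal.ofReal_le_ofReal_iff (by positivity)] at hs
      obtain ⟨n, hn1, hn2⟩ := exists_nat_pow_near_of_lt_one hD0
        (hs.trans (pow_le_one₀ (by norm_num) (by norm_num)))
        (by norm_num : (0 : ℝ) < 1 / 2) (by norm_num)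
      have hNn : N ≤ n := by
        by_contra hcon
        have : (1 / 2 : ℝ) ^ N ≤ (1 / 2) ^ (n + 1) :=
          pow_le_pow_of_le_one (by norm_num) (by norm_num) (by omega)
        linarith
      refine (hball s n hNn (by rw [hDe]; exact ENNReal.ofReal_le_ofReal hn2)).trans ?_
      rw [hC, hDe, mul_assoc, ← ENNReal.mul_rpow_of_nonneg _ _ hdr.le]
      gcongr
      rw [show (2 : ℝ≥0∞) = ENNReal.ofReal 2 by simp, ← ENNReal.ofReal_mul (by norm_num)]
      refine ENNReal.ofReal_le_ofReal ?_
      rw [pow_succ] at hn1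
      linarith
  have hle : C⁻¹ • ρ ≤ Measure.hausdorffMeasure (d : ℝ) := by
    refine Measure.le_hausdorffMeasure (d : ℝ) _ (ENNReal.ofReal ((1 / 2) ^ N))
      (ENNReal.ofReal_pos.2 (by positivity)) fun s hs => ?_
    rw [Measure.smul_apply, smul_eq_mul]
    refine (mul_le_mul_right (hfrost s hs) _).trans ?_
    rw [← mul_assoc, ENNReal.inv_mul_cancel hC0 hCt, one_mul]
  have hρX : ρ (XiSet XX) ≠ 0 := by
    have h1 := Measure.le_map_apply (μ := (PP z).restrict (G N)) (f := V) val_meas.aemeasurable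
      (XiSet XX)
    have h2 : V ⁻¹' (XiSet XX) = Set.univ := by
      ext ω
      simp only [Set.mem_preimage, Set.mem_univ, iff_true]
      exact ⟨Xr ω, Xr_mem ω, rfl⟩
    rw [h2, Measure.restrict_apply_univ] at h1
    intro h3
    rw [← hρ, h3] at h1
    exact hN (le_antisymm h1 (zero_le))
  intro h0
  have h1 := hle (XiSet XX)
  rw [h0, Measure.smul_apply, smul_eq_mul] at h1
  have h2 := le_antisymm h1 (zero_le)
  rcases mul_eq_zero.1 h2 with h3 | h3
  · exact hCt (ENNReal.inv_eq_zero.1 h3)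
  · exact hρX h3

/-- **Example (2-step Markov).** For `X = {x ∈ {0,1}^ℕ : x_k x_{2k} x_{4k} = 0}`,
`dim_H(Ξ) = 2 log₂ z` where `z ∈ (1,2]` satisfies `z⁷ - 2z⁵ + z³ - z - 1 = 0`. -/
theorem stmt18 (z : ℝ) (hz1 : 1 < z) (hz2 : z ≤ 2)
    (hz : z ^ 7 - 2 * z ^ 5 + z ^ 3 - z - 1 = 0) :
    dimH (XiSet {x : ℕ+ → Fin 2 | ∀ k : ℕ+,
        (x k : ℕ) * (x (2 * k) : ℕ) * (x (4 * k) : ℕ) = 0}) =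
      ENNReal.ofReal (2 * Real.logb 2 z) := by
  have : Fact (GoodZ z) := ⟨hz1, hz⟩
  have hl2 := Real.log_pos (by norm_num : (1 : ℝ) < 2)
  have hlz := Real.log_pos hz1
  have e0 : Real.log (tt z 0) = 2 * Real.log z := by
    simp [tt]
  have e1 : 2 * Real.logb 2 z = Real.log (tt z 0) / Real.log 2 := by
    rw [e0, Real.logb]
    ring
  have hpos : 0 ≤ 2 * Real.logb 2 z := by
    rw [e1, e0]
    positivity
  change dimH (XiSet XX) = _
  apply le_antisymm
  · refine dimH_le fun d hd => ?_
    by_contra! hcon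
    rw [← ENNReal.ofReal_coe_nnreal, ENNReal.ofReal_lt_ofReal_iff'] at hcon
    refine upper_bd z d ?_ hd
    have h := hcon.1
    rwa [e1, div_lt_iff₀ hl2] at h
  · refine ENNReal.le_of_forall_nnreal_lt fun d hd => ?_
    rcases eq_or_lt_of_le (zero_le (a := d)) with h0 | h0
    · rw [← h0]
      simp
    · rw [← ENNReal.ofReal_coe_nnreal, ENNReal.ofReal_lt_ofReal_iff'] at hd
      refine le_dimH_of_hausdorffMeasure_ne_zero (lower_bd z d h0 ?_)
      have h := hd.1
      rwa [e1, lt_div_iff₀ hl2] at h
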